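/- For every symmetric positive definite n×n matrix G, the supremum in the definition of 𝓕[G] is attained uniquely at the density ρ_G(x) = exp(-½ xᵀ A[G] x - U(x)) / Z[A[G]], where A[G] = ∇𝓕[G] is the unique symmetric matrix with ∇Ω[A[G]] = G. -/

import Mathlib

open MeasureTheory Matrix Filter Topology Real Asymptotics

attribute [local instance] Matrix.normedAddCommGroup Matrix.normedSpace

noncomputable section

/-- The partition function `Z[A] = ∫ exp(-½ xᵀAx - U(x)) dx`. -/
def Zfun (n : ℕ) (U : (Fin n → ℝ) → ℝ) (A : Matrix (Fin n) (Fin n) ℝ) : ℝ :=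
  ∫ x : Fin n → ℝ, Real.exp (-(1 / 2) * (x ⬝ᵥ A.mulVec x) - U x)

/-- The free energy `Ω[A] = -log Z[A]`. -/
def Omega (n : ℕ) (U : (Fin n → ℝ) → ℝ) (A : Matrix (Fin n) (Fin n) ℝ) : ℝ :=
  - Real.log (Zfun n U A)

/-- `U` is continuous with superquadratic growth: for every `c > 0`,
`U x - c * |x|² → +∞` as `|x| → ∞`. -/
def SuperQuadratic {n : ℕ} (U : (Fin n → ℝ) → ℝ) : Prop :=
  Continuous U ∧ ∀ c : ℝ, 0 < c →
    Tendsto (fun x : Fin n → ℝ => U x - c * ‖x‖ ^ 2) (cocompact _) atTop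

/-- A probability density on `ℝⁿ` with finite second moments and finite
differential entropy. -/
def IsGoodDensity {n : ℕ} (ρ : (Fin n → ℝ) → ℝ) : Prop :=
  Measurable ρ ∧ (∀ x, 0 ≤ ρ x) ∧ (∫ x, ρ x) = 1 ∧
  (∀ i j : Fin n, Integrable fun x => x i * x j * ρ x) ∧
  Integrable fun x => ρ x * Real.log (ρ x)

/-- Differential entropy `S(ρ) = -∫ ρ log ρ`. -/
def entropy {n : ℕ} (ρ : (Fin n → ℝ) → ℝ) : ℝ := - ∫ x, ρ x * Real.log (ρ x)

/-- Second-moment matrix `𝒢(ρ) = ∫ x xᵀ ρ(x) dx`. -/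
def momMatrix {n : ℕ} (ρ : (Fin n → ℝ) → ℝ) : Matrix (Fin n) (Fin n) ℝ :=
  Matrix.of fun i j => ∫ x, x i * x j * ρ x

/-- `𝓕[G;U] = sup { S(ρ) - ∫ U ρ : ρ ∈ 𝓜, 𝒢(ρ) = G }`. -/
def Ffun (n : ℕ) (U : (Fin n → ℝ) → ℝ) (G : Matrix (Fin n) (Fin n) ℝ) : ℝ :=
  sSup { r : ℝ | ∃ ρ : (Fin n → ℝ) → ℝ, IsGoodDensity ρ ∧
    (Integrable fun x => U x * ρ x) ∧ momMatrix ρ = G ∧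
    r = entropy ρ - ∫ x, U x * ρ x }

/-- The Luttinger-Ward functional `Φ[G;U] = 2𝓕[G;U] - Tr[log G] - n log(2πe)`.
(For positive definite `G`, `Tr[log G] = log det G`.) -/
def Phi (n : ℕ) (U : (Fin n → ℝ) → ℝ) (G : Matrix (Fin n) (Fin n) ℝ) : ℝ :=
  2 * Ffun n U G - Real.log G.det - (n : ℝ) * Real.log (2 * π * Real.exp 1)

/-- The continuous linear functional `H ↦ Tr[S * H]` on matrices. -/
def tracePairing {n : ℕ} (S : Matrix (Fin n) (Fin n) ℝ) :
    Matrix (Fin n) (Fin n) ℝ →L[ℝ] ℝ :=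
  LinearMap.toContinuousLinearMap
    { toFun := fun H => (S * H).trace
      map_add' := fun H K => by simp [Matrix.mul_add]
      map_smul' := fun c H => by simp [Matrix.mul_smul] }

section aux
variable {n : ℕ}

lemma aux_U_lower {U : (Fin n → ℝ) → ℝ} (hU : SuperQuadratic U) (c : ℝ) (hc : 0 < c) :
    ∃ C : ℝ, ∀ x, c * ‖x‖ ^ 2 - C ≤ U x := by
  obtain ⟨hUc, hUt⟩ := hU
  have hcont : Continuous (fun x : Fin n → ℝ => U x - c * ‖x‖ ^ 2) := by fun_prop
  obtain ⟨x0, hx0⟩ := hcont.exists_forall_le (hUt c hc)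
  refine ⟨-(U x0 - c * ‖x0‖ ^ 2), fun x => ?_⟩
  have := hx0 x
  linarith

lemma aux_sum_sq_le (x : Fin n → ℝ) : ∑ i, x i ^ 2 ≤ (n : ℝ) * ‖x‖ ^ 2 := by
  have h : ∀ i ∈ Finset.univ, x i ^ 2 ≤ ‖x‖ ^ 2 := fun i _ => by
    have h1 := norm_le_pi_norm x i
    rw [← sq_abs]
    exact pow_le_pow_left₀ (abs_nonneg _) h1 2
  have := Finset.sum_le_card_nsmul _ _ _ h
  simpa using this

lemma aux_int_gauss : Integrable (fun x : Fin n → ℝ => Real.exp (-∑ i, x i ^ 2)) := by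
  have h : ∀ i : Fin n, Integrable (fun t : ℝ => Real.exp (-1 * t ^ 2)) :=
    fun _ => integrable_exp_neg_mul_sq one_pos
  have := Integrable.fintype_prod (μ := fun _ : Fin n => (volume : Measure ℝ)) h
  refine (this.congr (ae_of_all _ fun x => ?_))
  simp [← Real.exp_sum]

lemma aux_int {U : (Fin n → ℝ) → ℝ} (hU : SuperQuadratic U) (K a : ℝ) (ha : 0 < a) :
    Integrable (fun x : Fin n → ℝ => Real.exp (K * ‖x‖ ^ 2 - a * U x)) := by
  obtain ⟨C, hC⟩ := aux_U_lower hU ((|K| + n + 1) / a) (by positivity)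
  have hUc := hU.1
  refine Integrable.mono' (aux_int_gauss.const_mul (Real.exp (a * C)))
    (by apply Continuous.aestronglyMeasurable; fun_prop) (ae_of_all _ fun x => ?_)
  rw [Real.norm_eq_abs, abs_of_pos (Real.exp_pos _), ← Real.exp_add]
  apply Real.exp_le_exp.2
  have h1 := mul_le_mul_of_nonneg_left (hC x) ha.le
  have h2 : a * ((|K| + n + 1) / a * ‖x‖ ^ 2 - C) = (|K| + n + 1) * ‖x‖ ^ 2 - a * C := by
    field_simp
  rw [h2] at h1
  have h3 := aux_sum_sq_le x
  have h4 : K * ‖x‖ ^ 2 ≤ |K| * ‖x‖ ^ 2 := by gcongr; exact le_abs_self K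
  nlinarith [sq_nonneg ‖x‖]

lemma aux_int_of_le {U : (Fin n → ℝ) → ℝ} (hU : SuperQuadratic U) (K a C : ℝ) (ha : 0 < a)
    {f : (Fin n → ℝ) → ℝ} (hf : Continuous f)
    (h : ∀ x, |f x| ≤ C * Real.exp (K * ‖x‖ ^ 2 - a * U x)) : Integrable f :=
  Integrable.mono' ((aux_int hU K a ha).const_mul C) hf.aestronglyMeasurable (ae_of_all _ h)

lemma aux_q_eq (A : Matrix (Fin n) (Fin n) ℝ) (x : Fin n → ℝ) :
    x ⬝ᵥ A.mulVec x = ∑ i, ∑ j, A i j * (x i * x j) := by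
  simp only [dotProduct, mulVec, Finset.mul_sum]
  refine Finset.sum_congr rfl fun i _ => Finset.sum_congr rfl fun j _ => by ring

lemma aux_xx (x : Fin n → ℝ) (i j : Fin n) : |x i * x j| ≤ ‖x‖ ^ 2 := by
  rw [abs_mul, sq]
  exact mul_le_mul (norm_le_pi_norm x i) (norm_le_pi_norm x j) (abs_nonneg _) (norm_nonneg _)

lemma aux_q_bound (A : Matrix (Fin n) (Fin n) ℝ) :
    ∃ K : ℝ, 0 ≤ K ∧ ∀ x : Fin n → ℝ, |x ⬝ᵥ A.mulVec x| ≤ K * ‖x‖ ^ 2 := by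
  refine ⟨∑ i, ∑ j, |A i j|, by positivity, fun x => ?_⟩
  rw [aux_q_eq, Finset.sum_mul]
  refine (Finset.abs_sum_le_sum_abs _ _).trans (Finset.sum_le_sum fun i _ => ?_)
  rw [Finset.sum_mul]
  refine (Finset.abs_sum_le_sum_abs _ _).trans (Finset.sum_le_sum fun j _ => ?_)
  rw [abs_mul]
  exact mul_le_mul_of_nonneg_left (aux_xx x i j) (abs_nonneg _)

lemma aux_q_cont (A : Matrix (Fin n) (Fin n) ℝ) :
    Continuous (fun x : Fin n → ℝ => x ⬝ᵥ A.mulVec x) := by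
  simp only [aux_q_eq]; fun_prop

lemma aux_w_cont {U : (Fin n → ℝ) → ℝ} (hU : SuperQuadratic U) (A : Matrix (Fin n) (Fin n) ℝ) :
    Continuous (fun x : Fin n → ℝ => Real.exp (-(1 / 2) * (x ⬝ᵥ A.mulVec x) - U x)) := by
  have := aux_q_cont A
  have := hU.1
  fun_prop

lemma aux_w_int {U : (Fin n → ℝ) → ℝ} (hU : SuperQuadratic U) (A : Matrix (Fin n) (Fin n) ℝ) :
    Integrable (fun x : Fin n → ℝ => Real.exp (-(1 / 2) * (x ⬝ᵥ A.mulVec x) - U x)) := by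
  obtain ⟨K, hK, hq⟩ := aux_q_bound A
  refine aux_int_of_le hU K 1 1 one_pos (aux_w_cont hU A) fun x => ?_
  rw [abs_of_pos (Real.exp_pos _), one_mul]
  apply Real.exp_le_exp.2
  have := abs_le.1 (hq x)
  nlinarith [mul_nonneg hK (sq_nonneg ‖x‖)]

lemma aux_Z_pos {U : (Fin n → ℝ) → ℝ} (hU : SuperQuadratic U) (A : Matrix (Fin n) (Fin n) ℝ) :
    0 < Zfun n U A := by
  unfold Zfun
  exact integral_exp_pos (aux_w_int hU A)

lemma aux_xxw_int {U : (Fin n → ℝ) → ℝ} (hU : SuperQuadratic U) (A : Matrix (Fin n) (Fin n) ℝ)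
    (i j : Fin n) :
    Integrable (fun x : Fin n → ℝ =>
      x i * x j * Real.exp (-(1 / 2) * (x ⬝ᵥ A.mulVec x) - U x)) := by
  obtain ⟨K, hK, hq⟩ := aux_q_bound A
  have hc := aux_w_cont hU A
  refine aux_int_of_le hU (K + 1) 1 1 one_pos (by fun_prop) fun x => ?_
  rw [abs_mul, abs_of_pos (Real.exp_pos _), one_mul]
  have h1 : |x i * x j| ≤ Real.exp (‖x‖ ^ 2) :=
    (aux_xx x i j).trans (by linarith [Real.add_one_le_exp (‖x‖ ^ 2)])
  refine (mul_le_mul_of_nonneg_right h1 (Real.exp_pos _).le).trans ?_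
  rw [← Real.exp_add]
  apply Real.exp_le_exp.2
  have := abs_le.1 (hq x)
  nlinarith [mul_nonneg hK (sq_nonneg ‖x‖)]

lemma aux_Uw_int {U : (Fin n → ℝ) → ℝ} (hU : SuperQuadratic U) (A : Matrix (Fin n) (Fin n) ℝ) :
    Integrable (fun x : Fin n → ℝ =>
      U x * Real.exp (-(1 / 2) * (x ⬝ᵥ A.mulVec x) - U x)) := by
  obtain ⟨K, hK, hq⟩ := aux_q_bound A
  obtain ⟨C, hC⟩ := aux_U_lower hU 1 one_pos
  have hc := aux_w_cont hU A
  have hUc := hU.1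
  refine aux_int_of_le hU K (1 / 2) (2 * Real.exp (|C|)) (by norm_num) (by fun_prop) fun x => ?_
  rw [abs_mul, abs_of_pos (Real.exp_pos _)]
  have h1 : |U x| ≤ 2 * Real.exp (|C| + U x / 2) := by
    have h2 := Real.add_one_le_exp (|C| + U x / 2)
    have h3 := hC x
    have h4 := le_abs_self C
    have h5 := sq_nonneg ‖x‖
    have h6 := abs_nonneg C
    rw [abs_le]
    constructor <;> nlinarith [Real.exp_pos (|C| + U x / 2)]
  refine (mul_le_mul_of_nonneg_right h1 (Real.exp_pos _).le).trans ?_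
  rw [mul_assoc, mul_assoc, ← Real.exp_add, ← Real.exp_add]
  refine mul_le_mul_of_nonneg_left ?_ (by norm_num)
  apply Real.exp_le_exp.2
  have := abs_le.1 (hq x)
  nlinarith [mul_nonneg hK (sq_nonneg ‖x‖)]

lemma aux_deriv {U : (Fin n → ℝ) → ℝ} (hU : SuperQuadratic U) (A H : Matrix (Fin n) (Fin n) ℝ) :
    HasDerivAt (fun t : ℝ => Zfun n U (A + t • H))
      (∫ x : Fin n → ℝ, (-(1 / 2) * (x ⬝ᵥ H.mulVec x)) *
        Real.exp (-(1 / 2) * (x ⬝ᵥ A.mulVec x) - U x)) 0 := by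
  obtain ⟨K, hK, hq⟩ := aux_q_bound A
  obtain ⟨M, hM, hr⟩ := aux_q_bound H
  have key := hasDerivAt_integral_of_dominated_loc_of_deriv_le (μ := volume) (𝕜 := ℝ)
    (F := fun (t : ℝ) (x : Fin n → ℝ) =>
      Real.exp (-(1 / 2) * (x ⬝ᵥ (A + t • H).mulVec x) - U x))
    (F' := fun (t : ℝ) (x : Fin n → ℝ) => (-(1 / 2) * (x ⬝ᵥ H.mulVec x)) *
        Real.exp (-(1 / 2) * (x ⬝ᵥ (A + t • H).mulVec x) - U x))
    (x₀ := 0) (s := Metric.ball 0 1)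
    (bound := fun x => M * Real.exp ((K + M + 1) * ‖x‖ ^ 2 - 1 * U x))
    (Metric.ball_mem_nhds _ one_pos)
    (Eventually.of_forall fun t => (aux_w_cont hU _).aestronglyMeasurable)
    (aux_w_int hU _)
    (by
      apply Continuous.aestronglyMeasurable
      have := aux_w_cont hU (A + (0:ℝ) • H)
      have := aux_q_cont H
      fun_prop)
    (ae_of_all _ fun x t ht => ?_)
    ((aux_int hU _ 1 one_pos).const_mul M)
    (ae_of_all _ fun x t ht => ?_)
  · simpa [Zfun] using key.2
  · have ht' : |t| ≤ 1 := by simpa using (le_of_lt (by simpa using ht : |t| < 1))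
    rw [Real.norm_eq_abs, abs_mul, abs_of_pos (Real.exp_pos _)]
    have h1 : |-(1 / 2) * (x ⬝ᵥ H.mulVec x)| ≤ M * Real.exp (‖x‖ ^ 2) := by
      rw [abs_mul]
      have h2 := hr x
      have h3 : M * ‖x‖ ^ 2 ≤ M * Real.exp (‖x‖ ^ 2) :=
        mul_le_mul_of_nonneg_left (by linarith [Real.add_one_le_exp (‖x‖ ^ 2)]) hM
      have h4 : |(-(1 / 2) : ℝ)| = 1 / 2 := by norm_num [abs_of_pos]
      rw [h4]
      nlinarith [abs_nonneg (x ⬝ᵥ H.mulVec x)]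
    refine (mul_le_mul_of_nonneg_right h1 (Real.exp_pos _).le).trans ?_
    rw [mul_assoc, ← Real.exp_add]
    refine mul_le_mul_of_nonneg_left ?_ hM
    apply Real.exp_le_exp.2
    have h5 := abs_le.1 (hq x)
    have h6 : |t * (x ⬝ᵥ H.mulVec x)| ≤ M * ‖x‖ ^ 2 := by
      rw [abs_mul]
      nlinarith [hr x, abs_nonneg (x ⬝ᵥ H.mulVec x), abs_nonneg t]
    have h7 := abs_le.1 h6
    rw [add_mulVec, smul_mulVec, dotProduct_add, dotProduct_smul, smul_eq_mul]
    nlinarith [mul_nonneg hK (sq_nonneg ‖x‖), mul_nonneg hM (sq_nonneg ‖x‖)]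
  · simp only [add_mulVec, smul_mulVec, dotProduct_add, dotProduct_smul, smul_eq_mul]
    have h1 : HasDerivAt (fun t : ℝ => -(1 / 2) * (x ⬝ᵥ A.mulVec x + t * (x ⬝ᵥ H.mulVec x)) - U x)
        (-(1 / 2) * (1 * (x ⬝ᵥ H.mulVec x))) t :=
      ((((hasDerivAt_id t).mul_const _).const_add _).const_mul _).sub_const _
    have h2 := h1.exp
    rw [one_mul, mul_comm] at h2
    exact h2

/-- the Gibbs density -/
def gibbs (U : (Fin n → ℝ) → ℝ) (A : Matrix (Fin n) (Fin n) ℝ) : (Fin n → ℝ) → ℝ :=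
  fun x => Real.exp (-(1 / 2) * (x ⬝ᵥ A.mulVec x) - U x) / Zfun n U A

lemma gibbs_mom {U : (Fin n → ℝ) → ℝ} (hU : SuperQuadratic U) (A G : Matrix (Fin n) (Fin n) ℝ)
    (hG : G.PosDef)
    (hAG : HasFDerivAt (Omega n U) (tracePairing ((1 / 2 : ℝ) • G)) A) :
    momMatrix (gibbs U A) = G := by
  have hZ := aux_Z_pos hU A
  ext i j
  set H : Matrix (Fin n) (Fin n) ℝ := Matrix.single i j 1 with hH
  have hq : ∀ x : Fin n → ℝ, x ⬝ᵥ H.mulVec x = x i * x j := by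
    intro x
    rw [aux_q_eq, Finset.sum_eq_single i, Finset.sum_eq_single j]
    · simp [hH]
    · intro b _ hb; simp [hH, Matrix.single, hb.symm]
    · simp
    · intro b _ hb; simp [hH, Matrix.single, hb.symm]
    · simp
  have d1 := aux_deriv hU A H
  have hZ0 : Zfun n U (A + (0:ℝ) • H) ≠ 0 := by simpa using hZ.ne'
  have d2 := (d1.log hZ0).neg
  have line : HasDerivAt (fun t : ℝ => A + t • H) H 0 := by
    have h := ((hasDerivAt_id (0:ℝ)).smul_const H).const_add A
    rw [one_smul] at h
    exact h
  have hAG' : HasFDerivAt (Omega n U) (tracePairing ((1 / 2 : ℝ) • G)) (A + (0:ℝ) • H) := by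
    simpa using hAG
  have d3 := hAG'.comp_hasDerivAt (0:ℝ) line
  have e := d2.unique d3
  have htr : tracePairing ((1 / 2 : ℝ) • G) H = 1 / 2 * G i j := by
    have hs : G j i = G i j := by simpa using hG.1.apply i j
    show (((1 / 2 : ℝ) • G) * H).trace = _
    rw [hH, Matrix.trace_mul_single]
    simp [hs]
  replace e := e.trans htr
  simp only [hq, zero_smul, add_zero] at e
  have e1 : ∫ x : Fin n → ℝ, (-(1 / 2) * (x i * x j)) *
        Real.exp (-(1 / 2) * (x ⬝ᵥ A.mulVec x) - U x) =
        -(1 / 2) * ∫ x : Fin n → ℝ, x i * x j *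
        Real.exp (-(1 / 2) * (x ⬝ᵥ A.mulVec x) - U x) := by
    rw [← integral_const_mul]
    simp only [mul_assoc]
  rw [e1] at e
  have e2 : momMatrix (gibbs U A) i j = (∫ x : Fin n → ℝ, x i * x j *
        Real.exp (-(1 / 2) * (x ⬝ᵥ A.mulVec x) - U x)) / Zfun n U A := by
    rw [← integral_div]
    simp only [momMatrix, gibbs, Matrix.of_apply, mul_div_assoc]
  rw [e2]
  linear_combination 2 * e

lemma gibbs_pos {U : (Fin n → ℝ) → ℝ} (hU : SuperQuadratic U) (A : Matrix (Fin n) (Fin n) ℝ)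
    (x : Fin n → ℝ) : 0 < gibbs U A x := div_pos (Real.exp_pos _) (aux_Z_pos hU A)

lemma gibbs_log {U : (Fin n → ℝ) → ℝ} (hU : SuperQuadratic U) (A : Matrix (Fin n) (Fin n) ℝ)
    (x : Fin n → ℝ) : Real.log (gibbs U A x) =
      -(1 / 2) * (x ⬝ᵥ A.mulVec x) - U x - Real.log (Zfun n U A) := by
  unfold gibbs
  rw [Real.log_div (Real.exp_pos _).ne' (aux_Z_pos hU A).ne', Real.log_exp]

lemma gibbs_cont {U : (Fin n → ℝ) → ℝ} (hU : SuperQuadratic U) (A : Matrix (Fin n) (Fin n) ℝ) :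
    Continuous (gibbs U A) := (aux_w_cont hU A).div_const _

lemma gibbs_U {U : (Fin n → ℝ) → ℝ} (hU : SuperQuadratic U) (A : Matrix (Fin n) (Fin n) ℝ) :
    Integrable (fun x => U x * gibbs U A x) := by
  simpa only [gibbs, mul_div_assoc] using (aux_Uw_int hU A).div_const (Zfun n U A)

lemma gibbs_xx {U : (Fin n → ℝ) → ℝ} (hU : SuperQuadratic U) (A : Matrix (Fin n) (Fin n) ℝ)
    (i j : Fin n) :
    Integrable (fun x => x i * x j * gibbs U A x) := by
  simpa only [gibbs, mul_div_assoc] using (aux_xxw_int hU A i j).div_const (Zfun n U A)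

lemma q_int (A : Matrix (Fin n) (Fin n) ℝ) {ρ : (Fin n → ℝ) → ℝ}
    (h : ∀ i j : Fin n, Integrable fun x => x i * x j * ρ x) :
    Integrable (fun x => (x ⬝ᵥ A.mulVec x) * ρ x) ∧
    ∫ x, (x ⬝ᵥ A.mulVec x) * ρ x = ∑ i, ∑ j, A i j * momMatrix ρ i j := by
  have e : (fun x => (x ⬝ᵥ A.mulVec x) * ρ x) =
      fun x => ∑ i, ∑ j, A i j * (x i * x j * ρ x) := by
    ext x
    rw [aux_q_eq]
    simp only [Finset.sum_mul, mul_assoc]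
  rw [e]
  have h1 : ∀ i j : Fin n, Integrable fun x => A i j * (x i * x j * ρ x) :=
    fun i j => (h i j).const_mul _
  refine ⟨integrable_finsetSum _ fun i _ => integrable_finsetSum _ fun j _ => h1 i j, ?_⟩
  rw [integral_finsetSum _ fun i _ => integrable_finsetSum _ fun j _ => h1 i j]
  refine Finset.sum_congr rfl fun i _ => ?_
  rw [integral_finsetSum _ fun j _ => h1 i j]
  refine Finset.sum_congr rfl fun j _ => ?_
  rw [integral_const_mul]; rfl

lemma gibbs_good {U : (Fin n → ℝ) → ℝ} (hU : SuperQuadratic U) (A : Matrix (Fin n) (Fin n) ℝ) :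
    IsGoodDensity (gibbs U A) := by
  refine ⟨(gibbs_cont hU A).measurable, fun x => (gibbs_pos hU A x).le, ?_, gibbs_xx hU A, ?_⟩
  · simp only [gibbs]
    rw [integral_div]
    exact div_self (aux_Z_pos hU A).ne'
  · have h1 := (q_int A (gibbs_xx hU A)).1.const_mul (-(1 / 2))
    have h2 := gibbs_U hU A
    have h3 : Integrable (gibbs U A) := (aux_w_int hU A).div_const _
    refine ((h1.sub h2).sub (h3.const_mul (Real.log (Zfun n U A)))).congr (ae_of_all _ fun x => ?_)
    simp only [gibbs_log hU, Pi.sub_apply]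
    ring

lemma gibbs_pt {r w : ℝ} (hr : 0 ≤ r) (hw : 0 < w) :
    0 ≤ r * Real.log r - r * Real.log w - r + w ∧
    (r * Real.log r - r * Real.log w - r + w = 0 → r = w) := by
  rcases hr.eq_or_lt with h | h
  · subst h; simp [hw.le, hw.ne']
  · have e : w / r - 1 - Real.log (w / r) = (r * Real.log r - r * Real.log w - r + w) / r := by
      rw [Real.log_div hw.ne' h.ne']; field_simp; ring
    constructor
    · have := Real.log_le_sub_one_of_pos (div_pos hw h)
      have h2 : 0 ≤ (r * Real.log r - r * Real.log w - r + w) / r := by linarith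
      have h3 := mul_nonneg h2 h.le
      rwa [div_mul_cancel₀ _ h.ne'] at h3
    · intro h0
      by_contra hne
      have h1 : w / r ≠ 1 := fun h1 => hne ((div_eq_one_iff_eq h.ne').1 h1).symm
      have := Real.log_lt_sub_one_of_pos (div_pos hw h) h1
      rw [h0, zero_div] at e
      linarith

lemma gibbs_var {U : (Fin n → ℝ) → ℝ} (hU : SuperQuadratic U) (A : Matrix (Fin n) (Fin n) ℝ)
    {ρ : (Fin n → ℝ) → ℝ} (hρ : IsGoodDensity ρ) (hUρ : Integrable fun x => U x * ρ x) :
    Integrable (fun x => ρ x * Real.log (ρ x) - ρ x * Real.log (gibbs U A x) - ρ x + gibbs U A x) ∧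
    ∫ x, (ρ x * Real.log (ρ x) - ρ x * Real.log (gibbs U A x) - ρ x + gibbs U A x) =
    (1 / 2 * ∑ i, ∑ j, A i j * momMatrix ρ i j + Real.log (Zfun n U A)) -
      (entropy ρ - ∫ x, U x * ρ x) := by
  obtain ⟨hm, h0, h1, hxx, hlog⟩ := hρ
  have hint : Integrable ρ := by
    by_contra hc
    rw [integral_undef hc] at h1
    exact zero_ne_one h1
  obtain ⟨hq, hqe⟩ := q_int A hxx
  have hgi : Integrable (gibbs U A) := (aux_w_int hU A).div_const _
  have hg1 : ∫ x, gibbs U A x = 1 := (gibbs_good hU A).2.2.1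
  have e : (fun x => ρ x * Real.log (ρ x) - ρ x * Real.log (gibbs U A x) - ρ x + gibbs U A x) =
      fun x => ρ x * Real.log (ρ x) + (1 / 2 * ((x ⬝ᵥ A.mulVec x) * ρ x) + (U x * ρ x +
        ((Real.log (Zfun n U A) - 1) * ρ x + gibbs U A x))) := by
    ext x
    rw [gibbs_log hU]
    ring
  rw [e]
  have i1 := hint.const_mul (Real.log (Zfun n U A) - 1)
  have i2 := i1.add hgi
  have i3 := hUρ.add i2
  have i4 := (hq.const_mul (1 / 2)).add i3
  refine ⟨hlog.add i4, ?_⟩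
  have s1 := integral_add hlog i4
  have s2 := integral_add (hq.const_mul (1 / 2)) i3
  have s3 := integral_add hUρ i2
  have s4 := integral_add i1 hgi
  simp only [Pi.add_apply] at s1 s2 s3 s4
  rw [s1, s2, s3, s4, integral_const_mul, integral_const_mul, hqe, h1, hg1, entropy]
  ring

lemma gibbs_le {U : (Fin n → ℝ) → ℝ} (hU : SuperQuadratic U) (A : Matrix (Fin n) (Fin n) ℝ)
    {ρ : (Fin n → ℝ) → ℝ} (hρ : IsGoodDensity ρ) (hUρ : Integrable fun x => U x * ρ x) :
    entropy ρ - ∫ x, U x * ρ x ≤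
      1 / 2 * ∑ i, ∑ j, A i j * momMatrix ρ i j + Real.log (Zfun n U A) := by
  have h := (gibbs_var hU A hρ hUρ).2
  have h2 := integral_nonneg (μ := volume)
    (f := fun x => ρ x * Real.log (ρ x) - ρ x * Real.log (gibbs U A x) - ρ x + gibbs U A x)
    (fun x => (gibbs_pt (hρ.2.1 x) (gibbs_pos hU A x)).1)
  linarith

lemma gibbs_eq {U : (Fin n → ℝ) → ℝ} (hU : SuperQuadratic U) (A : Matrix (Fin n) (Fin n) ℝ) :
    entropy (gibbs U A) - ∫ x, U x * gibbs U A x =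
      1 / 2 * ∑ i, ∑ j, A i j * momMatrix (gibbs U A) i j + Real.log (Zfun n U A) := by
  have h := (gibbs_var hU A (gibbs_good hU A) (gibbs_U hU A)).2
  simp at h
  simp
  linarith

lemma gibbs_uniq {U : (Fin n → ℝ) → ℝ} (hU : SuperQuadratic U) (A : Matrix (Fin n) (Fin n) ℝ)
    {ρ : (Fin n → ℝ) → ℝ} (hρ : IsGoodDensity ρ) (hUρ : Integrable fun x => U x * ρ x)
    (h : entropy ρ - ∫ x, U x * ρ x =
      1 / 2 * ∑ i, ∑ j, A i j * momMatrix ρ i j + Real.log (Zfun n U A)) :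
    ρ =ᵐ[volume] gibbs U A := by
  obtain ⟨hi, he⟩ := gibbs_var hU A hρ hUρ
  rw [h, sub_self, integral_eq_zero_iff_of_nonneg
    (fun x => (gibbs_pt (hρ.2.1 x) (gibbs_pos hU A x)).1) hi] at he
  filter_upwards [he] with x hx
  exact (gibbs_pt (hρ.2.1 x) (gibbs_pos hU A x)).2 hx

lemma gibbs_F {U : (Fin n → ℝ) → ℝ} (hU : SuperQuadratic U) (A G : Matrix (Fin n) (Fin n) ℝ)
    (hm : momMatrix (gibbs U A) = G) :
    IsGreatest { r : ℝ | ∃ ρ : (Fin n → ℝ) → ℝ, IsGoodDensity ρ ∧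
    (Integrable fun x => U x * ρ x) ∧ momMatrix ρ = G ∧
    r = entropy ρ - ∫ x, U x * ρ x } (entropy (gibbs U A) - ∫ x, U x * gibbs U A x) := by
  refine ⟨⟨gibbs U A, gibbs_good hU A, gibbs_U hU A, hm, rfl⟩, ?_⟩
  rintro r ⟨ρ, h1, h2, h3, rfl⟩
  rw [gibbs_eq hU, hm, ← h3]
  exact gibbs_le hU A h1 h2

lemma gibbs_inj {U : (Fin n → ℝ) → ℝ} (hU : SuperQuadratic U) {A A' : Matrix (Fin n) (Fin n) ℝ}
    (hA : A.IsSymm) (hA' : A'.IsSymm) (h : gibbs U A' = gibbs U A) : A' = A := by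
  have hl : ∀ x, Real.log (gibbs U A' x) = Real.log (gibbs U A x) := fun x => by rw [h]
  simp only [gibbs_log hU] at hl
  have h0 := hl 0
  simp at h0
  have hq : ∀ x : Fin n → ℝ, x ⬝ᵥ A'.mulVec x = x ⬝ᵥ A.mulVec x := fun x => by
    have := hl x; linarith
  have e : ∀ (B : Matrix (Fin n) (Fin n) ℝ) (i j : Fin n),
      Pi.single i 1 ⬝ᵥ B.mulVec (Pi.single j 1) = B i j := by
    intro B i j; simp
  ext i j
  have h1 := hq (Pi.single i 1)
  have h2 := hq (Pi.single j 1)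
  have h3 := hq (Pi.single i 1 + Pi.single j 1)
  simp only [mulVec_add, add_dotProduct, dotProduct_add, e] at h1 h2 h3
  have s1 := hA.apply i j
  have s2 := hA'.apply i j
  linarith

end aux

/-- for every symmetric positive definite `G`, the supremum defining `𝓕[G]`
is attained uniquely (up to a.e. equality) at
`ρ_G(x) = exp(-½ xᵀ A[G] x - U(x)) / Z[A[G]]`, where `A[G]` is the unique symmetric
matrix whose Green's function `∇Ω[A[G]]` equals `G` (the gradient being taken with
respect to the pairing `⟨A,G⟩ = ½ Tr[AG]`). -/
theorem statement8 (n : ℕ) (hn : 1 ≤ n) (U : (Fin n → ℝ) → ℝ) (hU : SuperQuadratic U)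
    (G : Matrix (Fin n) (Fin n) ℝ) (hG : G.PosDef)
    (A : Matrix (Fin n) (Fin n) ℝ) (hA : A.IsSymm)
    (hAG : HasFDerivAt (Omega n U) (tracePairing ((1 / 2 : ℝ) • G)) A)
    (ρG : (Fin n → ℝ) → ℝ)
    (hρG : ρG = fun x => Real.exp (-(1 / 2) * (x ⬝ᵥ A.mulVec x) - U x) / Zfun n U A) :
    (∀ A' : Matrix (Fin n) (Fin n) ℝ, A'.IsSymm →
      HasFDerivAt (Omega n U) (tracePairing ((1 / 2 : ℝ) • G)) A' → A' = A) ∧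
    IsGoodDensity ρG ∧ (Integrable fun x => U x * ρG x) ∧ momMatrix ρG = G ∧
    entropy ρG - (∫ x, U x * ρG x) = Ffun n U G ∧
    ∀ ρ : (Fin n → ℝ) → ℝ, IsGoodDensity ρ → (Integrable fun x => U x * ρ x) →
      momMatrix ρ = G → entropy ρ - (∫ x, U x * ρ x) = Ffun n U G →
      ρ =ᵐ[volume] ρG := by
  have hρ : ρG = gibbs U A := hρG
  subst hρ
  have hm := gibbs_mom hU A G hG hAG
  have hF : entropy (gibbs U A) - (∫ x, U x * gibbs U A x) = Ffun n U G :=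
    (gibbs_F hU A G hm).csSup_eq.symm
  have huniq : ∀ ρ : (Fin n → ℝ) → ℝ, IsGoodDensity ρ → (Integrable fun x => U x * ρ x) →
      momMatrix ρ = G → entropy ρ - (∫ x, U x * ρ x) = Ffun n U G →
      ρ =ᵐ[volume] gibbs U A := by
    intro ρ h1 h2 h3 h4
    refine gibbs_uniq hU A h1 h2 ?_
    rw [h4, ← hF, gibbs_eq hU, hm, h3]
  refine ⟨?_, gibbs_good hU A, gibbs_U hU A, hm, hF, huniq⟩
  intro A' hA' hAG'
  have hm' := gibbs_mom hU A' G hG hAG'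
  have hae := huniq (gibbs U A') (gibbs_good hU A') (gibbs_U hU A') hm'
    (gibbs_F hU A' G hm').csSup_eq.symm
  exact gibbs_inj hU hA hA' ((gibbs_cont hU A').ae_eq_iff_eq volume (gibbs_cont hU A) |>.1 hae)
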